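/- arXiv:2412.09120 — 2 statements merged into one kernel-verified Lean document; each statement's English description precedes it below -/
import Mathlib

section
/- Fix an integer r ≥ 2, take s = 1, and let S_1, …, S_r be arbitrary complex numbers. Then for every constant r×r complex matrix M there exists a polynomial P ∈ ℂ[z] such that for all nonzero z ∈ ℂ: z^{(r−1)·r} · ( det( z^{1−r}·Id − F(z) − M ) − det( z^{1−r}·Id − F(z) ) ) = P(z). In other words, the expression z^{(r−1)(r+1−s)}(D(z,M) − D(z,0)) is holomorphic at z = 0. -/
open Finset Matrix

/-- `⌊α_k⌋ = ⌊k(r−s)/r⌋`. -/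
noncomputable def alphaFloor (r s k : ℕ) : ℤ :=
  ⌊((k : ℚ) * ((r : ℚ) - (s : ℚ))) / (r : ℚ)⌋

/-- The shifted matrix `F(z)` of the `(r,s)` quantum curve:
`F(z)_{1,j} = (−1)^{j−1} S_j z^{r(⌊α_r⌋ − ⌊α_{r+1−j}⌋ − j)}` for `1 ≤ j ≤ r−1`,
`F(z)_{1,r} = (−1)^{r−1} S_r z^{r(⌊α_r⌋ − ⌊α_1⌋ − r)} + z^{−r⌊α_1⌋}`,
`F(z)_{k+1,k} = z^{r(⌊α_{r−k}⌋ − ⌊α_{r+1−k}⌋)}` for `1 ≤ k ≤ r−1`,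
all other entries `0` (indices `0`-based in Lean, so `S j` is `S_{j+1}`). -/
noncomputable def shiftedF (r s : ℕ) (S : Fin r → ℂ) (z : ℂ) : Matrix (Fin r) (Fin r) ℂ :=
  Matrix.of fun i j =>
    (if (i : ℕ) = 0 then
        (-1 : ℂ) ^ (j : ℕ) * S j *
            z ^ ((r : ℤ) * (alphaFloor r s r - alphaFloor r s (r - (j : ℕ)) - ((j : ℕ) + 1)))
          + (if (j : ℕ) = r - 1 then z ^ (-(r : ℤ) * alphaFloor r s 1) else 0)
      else 0)
    + (if (j : ℕ) + 1 = (i : ℕ) then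
        z ^ ((r : ℤ) * (alphaFloor r s (r - (i : ℕ)) - alphaFloor r s (r + 1 - (i : ℕ))))
      else 0)

lemma alphaFloor_one (r k : ℕ) (hk : 1 ≤ k) (hkr : k ≤ r) :
    alphaFloor r 1 k = (k : ℤ) - 1 := by
  unfold alphaFloor
  have hr : (0 : ℚ) < r := by exact_mod_cast (by omega : 0 < r)
  have h1 : (1 : ℚ) ≤ k := by exact_mod_cast hk
  have h2 : (k : ℚ) ≤ r := by exact_mod_cast hkr
  rw [Int.floor_eq_iff]
  push_cast
  constructor
  · rw [le_div_iff₀ hr]; nlinarith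
  · rw [div_lt_iff₀ hr]; nlinarith

/-- `z^r` times the unperturbed matrix, as a matrix of polynomials. -/
noncomputable def polyA (r : ℕ) (S : Fin r → ℂ) : Matrix (Fin r) (Fin r) (Polynomial ℂ) :=
  Matrix.of fun i j =>
    (if i = j then Polynomial.X else 0)
    - ((if (i : ℕ) = 0 then
        Polynomial.C ((-1 : ℂ) ^ (j : ℕ) * S j)
          + (if (j : ℕ) = r - 1 then Polynomial.X ^ r else 0)
      else 0)
    + (if (j : ℕ) + 1 = (i : ℕ) then 1 else 0))

lemma dvd_det_sub {n : ℕ} {R : Type*} [CommRing R] (a : R) (A B : Matrix (Fin n) (Fin n) R) :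
    a ∣ (A - a • B).det - A.det := by
  rw [← Ideal.mem_span_singleton, ← Ideal.Quotient.eq, RingHom.map_det, RingHom.map_det]
  congr 1
  ext i j
  simp only [RingHom.mapMatrix_apply, Matrix.map_apply, Matrix.sub_apply, Matrix.smul_apply,
    smul_eq_mul]
  rw [Ideal.Quotient.eq, Ideal.mem_span_singleton]
  exact ⟨-B i j, by ring⟩

lemma polyA_eval (r : ℕ) (S : Fin r → ℂ) (z : ℂ) (hz : z ≠ 0) :
    (Polynomial.evalRingHom z).mapMatrix (polyA r S) =
      z ^ r • (z ^ ((1 : ℤ) - (r : ℤ)) • (1 : Matrix (Fin r) (Fin r) ℂ) - shiftedF r 1 S z) := by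
  ext i j
  have hi := i.2
  have hj := j.2
  have e1 : alphaFloor r 1 r = (r : ℤ) - 1 := alphaFloor_one r r (by omega) le_rfl
  have e2 : alphaFloor r 1 (r - (j : ℕ)) = (r : ℤ) - j - 1 := by
    rw [alphaFloor_one r _ (by omega) (by omega)]; omega
  have e3 : alphaFloor r 1 1 = 0 := by
    rw [alphaFloor_one r _ (by omega) (by omega)]; simp
  have e4 : alphaFloor r 1 (r - (i : ℕ)) = (r : ℤ) - i - 1 := by
    rw [alphaFloor_one r _ (by omega) (by omega)]; omega
  have z0 : z ^ r ≠ 0 := pow_ne_zero _ hz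
  have z1 : z ^ r * z ^ ((1 : ℤ) - (r : ℤ)) = z := by
    rw [← zpow_natCast, ← zpow_add₀ hz]; simp
  have z2 : z ^ ((r : ℤ) * ((r : ℤ) - 1 - ((r : ℤ) - j - 1) - ((j : ℕ) + 1))) = (z ^ r)⁻¹ := by
    rw [show (r : ℤ) * ((r : ℤ) - 1 - ((r : ℤ) - j - 1) - ((j : ℕ) + 1)) = -(r : ℤ) by ring,
      _root_.zpow_neg, zpow_natCast]
  have z3 : (j : ℕ) + 1 = i → z ^ ((r : ℤ) * (alphaFloor r 1 (r - (i : ℕ))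
      - alphaFloor r 1 (r + 1 - (i : ℕ)))) = (z ^ r)⁻¹ := by
    intro h
    have e5 : alphaFloor r 1 (r + 1 - (i : ℕ)) = (r : ℤ) - i := by
      rw [alphaFloor_one r _ (by omega) (by omega)]; omega
    rw [e4, e5, show (r : ℤ) * ((r : ℤ) - i - 1 - ((r : ℤ) - i)) = -(r : ℤ) by ring,
      _root_.zpow_neg, zpow_natCast]
  have a1 : z ^ r * (z ^ ((1 : ℤ) - (r : ℤ)) * (1 : Matrix (Fin r) (Fin r) ℂ) i j)
      = if i = j then z else 0 := by
    rw [← mul_assoc, z1, Matrix.one_apply]; simp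
  simp only [RingHom.mapMatrix_apply, Matrix.map_apply, Matrix.sub_apply, Matrix.smul_apply,
    smul_eq_mul, polyA, shiftedF, Matrix.of_apply]
  rw [e1, e2, e3, z2, mul_sub, a1, mul_add]
  simp only [map_sub, map_add, Polynomial.coe_evalRingHom]
  congr 1
  · split_ifs <;> simp
  · congr 1
    · split_ifs <;> simp <;> field_simp
    · split_ifs with h
      · rw [z3 h]; simp [z0]
      · simp

/-- For `s = 1` and arbitrary shifts `S_1, …, S_r`, the expression
`z^{(r−1)r} (D(z,M) − D(z,0))` is a polynomial in `z`, i.e.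
`D(z,M) − D(z,0)` is holomorphic at `z = 0` for every constant matrix `M`. -/
theorem stmt11 (r : ℕ) (hr : 2 ≤ r) (S : Fin r → ℂ)
    (M : Matrix (Fin r) (Fin r) ℂ) :
    ∃ P : Polynomial ℂ, ∀ z : ℂ, z ≠ 0 →
      z ^ ((r - 1) * r) *
          ((z ^ ((1 : ℤ) - (r : ℤ)) • (1 : Matrix (Fin r) (Fin r) ℂ)
              - shiftedF r 1 S z - M).det
            - (z ^ ((1 : ℤ) - (r : ℤ)) • (1 : Matrix (Fin r) (Fin r) ℂ)
              - shiftedF r 1 S z).det)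
        = P.eval z := by
  obtain ⟨P, hP⟩ := dvd_det_sub (Polynomial.X ^ r : Polynomial ℂ) (polyA r S)
    (M.map Polynomial.C)
  refine ⟨P, fun z hz => ?_⟩
  have z0 : z ^ r ≠ 0 := pow_ne_zero _ hz
  have h := congrArg (Polynomial.evalRingHom z) hP
  have hM : (Polynomial.evalRingHom z).mapMatrix
      (polyA r S - (Polynomial.X ^ r : Polynomial ℂ) • M.map Polynomial.C) =
      z ^ r • (z ^ ((1 : ℤ) - (r : ℤ)) • (1 : Matrix (Fin r) (Fin r) ℂ)
        - shiftedF r 1 S z - M) := by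
    rw [map_sub, polyA_eval r S z hz, smul_sub _ _ M]
    congr 1
    ext i j
    simp
    exact mul_comm _ _
  rw [map_sub, RingHom.map_det, RingHom.map_det, hM, polyA_eval r S z hz, Matrix.det_smul,
    Matrix.det_smul, ← mul_sub, map_mul] at h
  simp only [Polynomial.coe_evalRingHom, Polynomial.eval_pow, Polynomial.eval_X,
    Fintype.card_fin] at h
  apply mul_left_cancel₀ z0
  rw [← h, ← mul_assoc, ← pow_add, ← pow_mul]
  congr 2
  obtain ⟨k, rfl⟩ : ∃ k, r = k + 1 := ⟨r - 1, by omega⟩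
  simp only [Nat.add_sub_cancel]
  ring
end

section
/- Fix integers r ≥ 2 and s with 2 ≤ s ≤ r, and complex numbers S_1, …, S_r. Assume that either (i) r ≡ 1 (mod s) and S_j = 0 for all 2 ≤ j ≤ r, or (ii) r mod s ∈ {1, s−1} and S_j = 0 for all 1 ≤ j ≤ r. Then for every constant r×r complex matrix M there exists a polynomial P ∈ ℂ[z] such that for all nonzero z ∈ ℂ: z^{(r−1)(r+1−s)} · ( det( z^{s−r}·Id − F(z) − M ) − det( z^{s−r}·Id − F(z) ) ) = P(z). -/
open Finset Matrix

/-- `z^n f(z)` is polynomial in `z`. -/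
def PoleLE (f : ℂ → ℂ) (n : ℤ) : Prop :=
  ∃ P : Polynomial ℂ, ∀ z : ℂ, z ≠ 0 → z ^ n * f z = P.eval z

theorem PoleLE.mono {f : ℂ → ℂ} {n m : ℤ} (h : PoleLE f n) (hnm : n ≤ m) : PoleLE f m := by
  obtain ⟨P, hP⟩ := h
  refine ⟨Polynomial.X ^ (m - n).toNat * P, fun z hz => ?_⟩
  rw [Polynomial.eval_mul, Polynomial.eval_pow, Polynomial.eval_X, ← hP z hz, ← mul_assoc,
    ← zpow_natCast z, ← zpow_add₀ hz]
  congr 2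
  omega

theorem PoleLE.add {f g : ℂ → ℂ} {n : ℤ} (hf : PoleLE f n) (hg : PoleLE g n) :
    PoleLE (fun z => f z + g z) n := by
  obtain ⟨P, hP⟩ := hf
  obtain ⟨Q, hQ⟩ := hg
  refine ⟨P + Q, fun z hz => ?_⟩
  rw [Polynomial.eval_add, ← hP z hz, ← hQ z hz]
  ring

theorem PoleLE.sub {f g : ℂ → ℂ} {n : ℤ} (hf : PoleLE f n) (hg : PoleLE g n) :
    PoleLE (fun z => f z - g z) n := by
  obtain ⟨P, hP⟩ := hf
  obtain ⟨Q, hQ⟩ := hg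
  refine ⟨P - Q, fun z hz => ?_⟩
  rw [Polynomial.eval_sub, ← hP z hz, ← hQ z hz]
  ring

theorem PoleLE.mul {f g : ℂ → ℂ} {n m : ℤ} (hf : PoleLE f n) (hg : PoleLE g m) :
    PoleLE (fun z => f z * g z) (n + m) := by
  obtain ⟨P, hP⟩ := hf
  obtain ⟨Q, hQ⟩ := hg
  refine ⟨P * Q, fun z hz => ?_⟩
  rw [Polynomial.eval_mul, ← hP z hz, ← hQ z hz, zpow_add₀ hz]
  ring

theorem PoleLE.const (c : ℂ) {n : ℤ} (hn : 0 ≤ n) : PoleLE (fun _ => c) n := by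
  refine PoleLE.mono (n := 0) ⟨Polynomial.C c, fun z _ => ?_⟩ hn
  simp

theorem PoleLE.zero (n : ℤ) : PoleLE (fun _ => 0) n :=
  ⟨0, fun z _ => by simp⟩

theorem PoleLE.zpow {e n : ℤ} (hn : 0 ≤ n + e) : PoleLE (fun z => z ^ e) n := by
  refine PoleLE.mono (n := -e) ⟨1, fun z hz => ?_⟩ (by omega)
  rw [← zpow_add₀ hz]
  simp

theorem PoleLE.sum {ι : Type*} (t : Finset ι) {f : ι → ℂ → ℂ} {n : ℤ}
    (h : ∀ i ∈ t, PoleLE (f i) n) : PoleLE (fun z => ∑ i ∈ t, f i z) n := by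
  classical
  induction t using Finset.induction_on with
  | empty => simpa using PoleLE.zero n
  | insert a t ha ih =>
    simp only [Finset.sum_insert ha]
    exact (h a (by simp)).add (ih fun i hi => h i (by simp [hi]))

theorem PoleLE.prod {ι : Type*} (t : Finset ι) {f : ι → ℂ → ℂ} {w : ι → ℤ}
    (h : ∀ i ∈ t, PoleLE (f i) (w i)) : PoleLE (fun z => ∏ i ∈ t, f i z) (∑ i ∈ t, w i) := by
  classical
  induction t using Finset.induction_on with
  | empty => simpa using PoleLE.const 1 le_rfl
  | insert a t ha ih =>
    simp only [Finset.sum_insert ha, Finset.prod_insert ha]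
    exact (h a (by simp)).mul (ih fun i hi => h i (by simp [hi]))

theorem PoleLE.det_sub {r : ℕ} (B : ℂ → Matrix (Fin r) (Fin r) ℂ) (M : Matrix (Fin r) (Fin r) ℂ)
    (N : ℤ)
    (h : ∀ (σ : Equiv.Perm (Fin r)) (i₀ : Fin r), ∃ w : Fin r → ℤ,
      (∀ i, i ≠ i₀ → 0 ≤ w i ∧ PoleLE (fun z => B z (σ i) i) (w i)) ∧
      ∑ i ∈ Finset.univ.erase i₀, w i ≤ N) :
    PoleLE (fun z => (B z - M).det - (B z).det) N := by
  have key : ∀ z, (B z - M).det - (B z).det =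
      ∑ σ : Equiv.Perm (Fin r), ((Equiv.Perm.sign σ : ℤ) : ℂ) * ∑ i₀ : Fin r, -M (σ i₀) i₀ *
        ∏ i ∈ Finset.univ.erase i₀,
          if i < i₀ then B z (σ i) i + -M (σ i) i else B z (σ i) i := by
    intro z
    rw [Matrix.det_apply', Matrix.det_apply', ← Finset.sum_sub_distrib]
    refine Finset.sum_congr rfl fun σ _ => ?_
    rw [← mul_sub]
    congr 1
    have h1 := Finset.prod_add_ordered (Finset.univ : Finset (Fin r))
      (fun i => B z (σ i) i) (fun i => -M (σ i) i)
    have h2 : ∏ i, (B z - M) (σ i) i = ∏ i, (B z (σ i) i + -M (σ i) i) := by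
      refine Finset.prod_congr rfl fun i _ => ?_
      simp [sub_eq_add_neg]
    rw [h2, h1, add_sub_cancel_left]
    refine Finset.sum_congr rfl fun i₀ _ => ?_
    rw [mul_assoc]
    congr 1
    rw [Finset.prod_ite]
    congr 1
    · refine Finset.prod_congr ?_ fun _ _ => rfl
      ext i
      simp only [Finset.mem_filter, Finset.mem_univ, Finset.mem_erase, true_and, and_true]
      exact ⟨fun h => ⟨h.ne, h⟩, fun h => h.2⟩
    · refine Finset.prod_congr ?_ fun _ _ => rfl
      ext i
      simp only [Finset.mem_filter, Finset.mem_univ, Finset.mem_erase, true_and, and_true, not_lt]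
      exact ⟨fun h => ⟨h.ne', h.le⟩, fun h => lt_of_le_of_ne h.2 h.1.symm⟩
  simp only [key]
  refine PoleLE.sum _ fun σ _ => ?_
  rw [← zero_add N]
  refine PoleLE.mul (PoleLE.const _ le_rfl) (PoleLE.sum _ fun i₀ _ => ?_)
  rw [← zero_add N]
  refine PoleLE.mul (PoleLE.const _ le_rfl) ?_
  obtain ⟨w, hw, hN⟩ := h σ i₀
  refine PoleLE.mono (PoleLE.prod _ (w := w) fun i hi => ?_) hN
  obtain ⟨h0, hB⟩ := hw i (Finset.ne_of_mem_erase hi)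
  by_cases hlt : i < i₀
  · simp only [hlt, if_true]
    exact hB.add (PoleLE.const _ h0)
  · simpa only [hlt, if_false] using hB

theorem alphaFloor_eq (r s k : ℕ) : alphaFloor r s k = ((k : ℤ) * ((r : ℤ) - s)) / (r : ℤ) := by
  unfold alphaFloor
  have := Rat.floor_intCast_div_natCast ((k : ℤ) * ((r : ℤ) - s)) r
  push_cast at this
  exact this

theorem alphaFloor_one_s12 {r s : ℕ} (hs : 1 ≤ s) (hsr : s ≤ r) : alphaFloor r s 1 = 0 := by
  rw [alphaFloor_eq]
  apply Int.ediv_eq_zero_of_lt <;> push_cast <;> omega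

theorem alphaFloor_succ_le {r s : ℕ} (hr : 0 < r) (k : ℕ) :
    alphaFloor r s (k + 1) ≤ alphaFloor r s k + 1 := by
  rw [alphaFloor_eq, alphaFloor_eq]
  have h : (0 : ℤ) < r := by exact_mod_cast hr
  rw [← Int.add_mul_ediv_right _ _ h.ne']
  apply Int.ediv_le_ediv h
  push_cast
  nlinarith

theorem alphaFloor_succ_le' {r s : ℕ} (hr : 0 < r) (k : ℕ) (m : ℤ)
    (h1 : m * r ≤ (k : ℤ) * ((r : ℤ) - s)) (h2 : ((k : ℤ) + 1) * ((r : ℤ) - s) < (m + 1) * r) :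
    alphaFloor r s (k + 1) ≤ alphaFloor r s k := by
  rw [alphaFloor_eq, alphaFloor_eq]
  have h : (0 : ℤ) < r := by exact_mod_cast hr
  have h3 := (Int.le_ediv_iff_mul_le h).2 h1
  have h4 : (((k + 1 : ℕ) : ℤ) * ((r : ℤ) - s)) / (r : ℤ) < m + 1 := by
    rw [Int.ediv_lt_iff_lt_mul h]
    push_cast
    exact h2
  omega

theorem entry_bound {r s : ℕ} (hr : 2 ≤ r) (hs : 1 ≤ s) (hsr : s ≤ r) (S : Fin r → ℂ)
    (hS : ∀ j : Fin r, 1 ≤ (j : ℕ) → S j = 0) (a b : Fin r) (n : ℤ) (h0 : 0 ≤ n)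
    (hd : a = b → (r : ℤ) - s ≤ n)
    (he : (b : ℕ) + 1 = a →
      (r : ℤ) * (alphaFloor r s (r + 1 - (a : ℕ)) - alphaFloor r s (r - (a : ℕ))) ≤ n)
    (hS0 : (a : ℕ) = 0 → (b : ℕ) = 0 → (∃ j, S j ≠ 0) → (r : ℤ) ≤ n) :
    PoleLE (fun z => (z ^ ((s : ℤ) - (r : ℤ)) • (1 : Matrix (Fin r) (Fin r) ℂ)
              - shiftedF r s S z) a b) n := by
  simp only [Matrix.sub_apply, Matrix.smul_apply, Matrix.one_apply, shiftedF, Matrix.of_apply,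
    smul_eq_mul]
  refine PoleLE.sub ?_ (PoleLE.add ?_ ?_)
  · by_cases hab : a = b
    · simp only [hab, if_true, mul_one]
      exact PoleLE.zpow (by have := hd hab; omega)
    · simpa only [hab, if_false, mul_zero] using PoleLE.zero n
  · by_cases ha : (a : ℕ) = 0
    · simp only [ha, if_true]
      refine PoleLE.add ?_ ?_
      · by_cases hSb : S b = 0
        · simpa only [hSb, mul_zero, zero_mul] using PoleLE.zero n
        · have hb : (b : ℕ) = 0 := by
            by_contra hb
            exact hSb (hS b (by omega))
          have := hS0 ha hb ⟨b, hSb⟩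
          rw [← zero_add n]
          refine PoleLE.mul (PoleLE.const _ le_rfl) (PoleLE.zpow ?_)
          simp only [hb]
          simp
          omega
      · by_cases hb : (b : ℕ) = r - 1
        · simp only [hb, if_true]
          refine PoleLE.zpow ?_
          rw [alphaFloor_one_s12 hs hsr]
          simpa using h0
        · simpa only [hb, if_false] using PoleLE.zero n
    · simpa only [ha, if_false] using PoleLE.zero n
  · by_cases hab : (b : ℕ) + 1 = a
    · simp only [hab, if_true]
      refine PoleLE.zpow ?_
      have := he hab
      nlinarith
    · simpa only [hab, if_false] using PoleLE.zero n

/-- Sum of dual potentials over all columns but one. -/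
theorem sum_potential {r : ℕ} (σ : Equiv.Perm (Fin r)) (i₀ : Fin r) (x y : Fin r → ℤ) :
    ∑ i ∈ Finset.univ.erase i₀, (x (σ i) + y i) = ∑ i, (x i + y i) - (x (σ i₀) + y i₀) := by
  have h1 := Finset.sum_erase_add Finset.univ (fun i => x (σ i) + y i) (Finset.mem_univ i₀)
  have h2 : ∑ i, (x (σ i) + y i) = ∑ i, (x i + y i) := by
    rw [Finset.sum_add_distrib, Finset.sum_add_distrib, Equiv.sum_comp σ x]
  rw [← h2, ← h1]
  ring

/-- Potentials in the case `r = q s + 1`. -/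
def tauA (q s i : ℕ) : ℤ := if i = 0 then 0 else 1 + (((i - 1) % q : ℕ) : ℤ) * s

theorem tauA_nonneg (q s i : ℕ) : 0 ≤ tauA q s i := by
  unfold tauA
  split_ifs <;> positivity

theorem tauA_pos (q s i : ℕ) (h : i ≠ 0) : 1 ≤ tauA q s i := by
  unfold tauA
  rw [if_neg h]
  have : 0 ≤ (((i - 1) % q : ℕ) : ℤ) * s := by positivity
  omega

theorem tauA_le {r q s i : ℕ} (hq : 1 ≤ q) (hr : r = q * s + 1) :
    tauA q s i ≤ (r : ℤ) - s := by
  have h1 : (((i - 1) % q : ℕ) : ℤ) + 1 ≤ q := by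
    have := Nat.mod_lt (i - 1) (show q > 0 by omega)
    exact_mod_cast this
  have hq' : (1 : ℤ) ≤ q := by exact_mod_cast hq
  have hs0 : (0 : ℤ) ≤ s := by positivity
  have hr' : (r : ℤ) = q * s + 1 := by exact_mod_cast hr
  unfold tauA
  split_ifs
  · nlinarith
  · nlinarith

theorem edgeA {r q s a b : ℕ} (hq : 1 ≤ q) (hr : r = q * s + 1) (ha : a < r) (hb : b ≠ 0)
    (hab : b + 1 = a) :
    (r : ℤ) * (alphaFloor r s (r + 1 - a) - alphaFloor r s (r - a)) ≤
      (r : ℤ) - s + tauA q s a - tauA q s b := by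
  have e1 : r + 1 - a = (r - a) + 1 := by omega
  rw [e1]
  have hr0 : (0 : ℤ) < r := by omega
  have htb := tauA_le (i := b) hq hr
  have hta := tauA_nonneg q s a
  obtain ⟨c, hc⟩ : ∃ c, c = b / q := ⟨_, rfl⟩
  have hdm := Nat.div_add_mod b q
  have hml := Nat.mod_lt b (show q > 0 by omega)
  by_cases hm : b % q = 0
  · have hbq : b = q * c := by rw [hc]; omega
    have hc1 : 1 ≤ c := by
      rcases Nat.eq_zero_or_pos c with h | h
      · subst h; simp at hbq; omega
      · exact h
    have hcs : c < s := by
      have : q * c < q * s := by omega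
      exact lt_of_mul_lt_mul_left this (Nat.zero_le _)
    obtain ⟨j, rfl⟩ : ∃ j, s = c + j := ⟨s - c, by omega⟩
    have hk : r - a = j * q := by
      rw [hr, ← hab, hbq, Nat.mul_add, Nat.mul_comm j q]; omega
    have : alphaFloor r (c + j) (r - a + 1) ≤ alphaFloor r (c + j) (r - a) := by
      apply alphaFloor_succ_le' (by omega) _ ((j : ℤ) * ((q : ℤ) - 1))
      · rw [hk, hr]
        push_cast
        nlinarith
      · rw [hk, hr]
        have : (1 : ℤ) ≤ c := by exact_mod_cast hc1
        push_cast
        nlinarith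
    nlinarith
  · have h1 := alphaFloor_succ_le (r := r) (s := s) (by omega) (r - a)
    have h2 : tauA q s a = tauA q s b + s := by
      unfold tauA
      rw [if_neg (by omega), if_neg hb]
      have : (a - 1) % q = (b - 1) % q + 1 := by
        have e : a - 1 = (b - 1) + 1 := by omega
        have e2 : b = (b - 1) + 1 := by omega
        rw [e, Nat.add_mod_of_add_mod_lt]
        · by_cases hq1 : q = 1
          · subst hq1; omega
          · rw [Nat.mod_eq_of_lt (show 1 < q by omega)]
        · by_contra hcon
          have hl := Nat.mod_lt (b - 1) (show q > 0 by omega)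
          by_cases hq1 : q = 1
          · subst hq1; omega
          · rw [Nat.mod_eq_of_lt (show 1 < q by omega)] at hcon
            apply hm
            rw [e2, Nat.add_mod, Nat.mod_eq_of_lt (show 1 < q by omega),
              show (b - 1) % q + 1 = q by omega, Nat.mod_self]
      rw [this]
      push_cast
      ring
    rw [h2]
    nlinarith

theorem caseA {r q s : ℕ} (hr : 2 ≤ r) (hs : 2 ≤ s) (hsr : s ≤ r) (hq : 1 ≤ q)
    (hrq : r = q * s + 1) (S : Fin r → ℂ)
    (hS : ∀ j : Fin r, 1 ≤ (j : ℕ) → S j = 0) (M : Matrix (Fin r) (Fin r) ℂ) :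
    PoleLE (fun z => (z ^ ((s : ℤ) - (r : ℤ)) • (1 : Matrix (Fin r) (Fin r) ℂ)
              - shiftedF r s S z - M).det
            - (z ^ ((s : ℤ) - (r : ℤ)) • (1 : Matrix (Fin r) (Fin r) ℂ)
              - shiftedF r s S z).det) ((r : ℤ) * ((r : ℤ) - s) + s - 1) := by
  refine PoleLE.det_sub (fun z => z ^ ((s : ℤ) - (r : ℤ)) • (1 : Matrix (Fin r) (Fin r) ℂ)
              - shiftedF r s S z) M _ fun σ i₀ => ?_
  have t0 : tauA q s 0 = 0 := by simp [tauA]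
  have t1 : tauA q s 1 = 1 := by simp [tauA]
  have hsr' : (s : ℤ) ≤ r := by exact_mod_cast hsr
  have hr0 : (0 : ℤ) < r := by omega
  let z0 : Fin r := ⟨0, by omega⟩
  by_cases hcase : σ z0 = z0 ∧ i₀ ≠ z0
  · obtain ⟨hσ, hi₀⟩ := hcase
    let x : Fin r → ℤ := fun i => (r : ℤ) - s + tauA q s i + if (i : ℕ) = 0 then (s : ℤ) else 0
    let y : Fin r → ℤ := fun i => - tauA q s i
    refine ⟨fun i => x (σ i) + y i, fun i hi => ?_, ?_⟩
    · have ha := tauA_nonneg q s (σ i)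
      have hb := tauA_le (i := (i : ℕ)) hq hrq
      have hn : 0 ≤ x (σ i) + y i := by
        simp only [x, y]
        split_ifs <;> omega
      refine ⟨hn, entry_bound hr (by omega) hsr S hS _ _ _ hn ?_ ?_ ?_⟩
      · intro h
        simp only [x, y, h]
        split_ifs <;> omega
      · intro h
        have hi0 : (i : ℕ) ≠ 0 := by
          intro h0
          have : i = z0 := Fin.ext h0
          rw [this, hσ] at h
          simp at h
        have := edgeA hq hrq (σ i).2 hi0 h
        simp only [x, y]
        split_ifs <;> omega
      · intro h1 h2 _
        simp only [x, y, h1, h2, t0, if_true]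
        omega
    · rw [sum_potential]
      have hσ0 : (σ i₀ : ℕ) ≠ 0 := by
        intro h
        have : σ i₀ = z0 := Fin.ext h
        rw [← hσ] at this
        exact hi₀ (σ.injective this)
      have h1 : x (σ i₀) + y i₀ ≥ 1 := by
        have ha := tauA_pos q s (σ i₀) hσ0
        have hb := tauA_le (i := (i₀ : ℕ)) hq hrq
        simp only [x, y, hσ0, if_false]
        omega
      have h2 : ∑ i, (x i + y i) = (r : ℤ) * ((r : ℤ) - s) + s := by
        have : ∀ i : Fin r, x i + y i = ((r : ℤ) - s) + if i = z0 then (s : ℤ) else 0 := by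
          intro i
          have : (i : ℕ) = 0 ↔ i = z0 := by rw [Fin.ext_iff]
          simp only [x, y, this]
          ring
        simp only [this, Finset.sum_add_distrib, Finset.sum_const, Finset.card_univ,
          Fintype.card_fin, nsmul_eq_mul, Finset.sum_ite_eq', Finset.mem_univ, if_true]
      omega
  · let z1 : Fin r := ⟨1, by omega⟩
    let x : Fin r → ℤ := fun i => (r : ℤ) - s + tauA q s i +
      if (i : ℕ) = 1 then (s : ℤ) - 1 else 0
    let y : Fin r → ℤ := fun i => - tauA q s i
    have hxy : ∀ a b : Fin r, 0 ≤ x a + y b := by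
      intro a b
      have ha := tauA_nonneg q s a
      have hb := tauA_le (i := (b : ℕ)) hq hrq
      simp only [x, y]
      split_ifs <;> omega
    refine ⟨fun i => x (σ i) + y i, fun i hi => ?_, ?_⟩
    · refine ⟨hxy _ _, entry_bound hr (by omega) hsr S hS _ _ _ (hxy _ _) ?_ ?_ ?_⟩
      · intro h
        simp only [x, y, h]
        split_ifs <;> omega
      · intro h
        by_cases hi0 : (i : ℕ) = 0
        · have h1 : (σ i : ℕ) = 1 := by omega
          have h2 := alphaFloor_succ_le (r := r) (s := s) (by omega) (r - 1)
          simp only [x, y, h1, hi0, t0, t1, if_true]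
          rw [show r + 1 - 1 = r - 1 + 1 by omega]
          nlinarith
        · have := edgeA hq hrq (σ i).2 hi0 h
          simp only [x, y]
          split_ifs <;> omega
      · intro h1 h2 _
        exfalso
        apply hcase
        have e1 : i = z0 := Fin.ext h2
        have e2 : σ i = z0 := Fin.ext h1
        subst e1
        exact ⟨e2, fun h => hi h.symm⟩
    · rw [sum_potential]
      have h1 := hxy (σ i₀) i₀
      have h2 : ∑ i, (x i + y i) = (r : ℤ) * ((r : ℤ) - s) + (s - 1) := by
        have : ∀ i : Fin r, x i + y i = ((r : ℤ) - s) + if i = z1 then (s : ℤ) - 1 else 0 := by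
          intro i
          have : (i : ℕ) = 1 ↔ i = z1 := by rw [Fin.ext_iff]
          simp only [x, y, this]
          ring
        simp only [this, Finset.sum_add_distrib, Finset.sum_const, Finset.card_univ,
          Fintype.card_fin, nsmul_eq_mul, Finset.sum_ite_eq', Finset.mem_univ, if_true]
      omega

/-- Potentials in the case `r = q s - 1`. -/
def tauB (q s i : ℕ) : ℤ :=
  (s : ℤ) - 1 + ((i % q : ℕ) : ℤ) * s + if i / q = s - 1 then 1 else 0

theorem tauB_le {r q s i : ℕ} (hq : 2 ≤ q) (hs : 2 ≤ s) (hr : r + 1 = q * s) (hi : i < r) :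
    tauB q s i ≤ r := by
  have hml := Nat.mod_lt i (show q > 0 by omega)
  have hdm := Nat.div_add_mod i q
  have hr' : (r : ℤ) + 1 = q * s := by exact_mod_cast hr
  unfold tauB
  split_ifs with h
  · rw [h] at hdm
    have h1 : i % q + 2 ≤ q := by
      have : q * (s - 1) + q = q * s := by
        rw [← Nat.mul_succ]; congr 1; omega
      omega
    have h1' : ((i % q : ℕ) : ℤ) + 2 ≤ q := by exact_mod_cast h1
    have hs' : (2 : ℤ) ≤ s := by exact_mod_cast hs
    nlinarith
  · have h1' : ((i % q : ℕ) : ℤ) + 1 ≤ q := by exact_mod_cast hml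
    have hs' : (2 : ℤ) ≤ s := by exact_mod_cast hs
    nlinarith

/-- Row potentials in the case `r = q s - 1`. -/
def rowB (r q s i : ℕ) : ℤ := if i % q = 0 then (r : ℤ) else (r : ℤ) - s + tauB q s i

theorem rowB_ge {r q s i : ℕ} (hs : 2 ≤ s) : (r : ℤ) ≤ rowB r q s i := by
  unfold rowB
  split_ifs with h
  · exact le_rfl
  · have h1 : (1 : ℤ) ≤ ((i % q : ℕ) : ℤ) := by
      have : 1 ≤ i % q := by omega
      exact_mod_cast this
    have hs' : (2 : ℤ) ≤ s := by exact_mod_cast hs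
    unfold tauB
    split_ifs <;> nlinarith

theorem rowB_diag {r q s i : ℕ} (hs : 2 ≤ s) :
    rowB r q s i - tauB q s i = (r : ℤ) - s + if i % q = 0 ∧ i / q ≠ s - 1 then 1 else 0 := by
  unfold rowB
  by_cases h : i % q = 0
  · unfold tauB
    by_cases h' : i / q = s - 1
    · simp [h, h']
    · simp [h, h']
      ring
  · simp [h]

theorem edgeB {r q s a b : ℕ} (hq : 2 ≤ q) (hs : 2 ≤ s) (hr : r + 1 = q * s) (ha : a < r)
    (hab : b + 1 = a) :
    (r : ℤ) * (alphaFloor r s (r + 1 - a) - alphaFloor r s (r - a)) ≤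
      rowB r q s a - tauB q s b := by
  have e1 : r + 1 - a = (r - a) + 1 := by omega
  rw [e1]
  have hr0 : (0 : ℤ) < r := by omega
  have htb := tauB_le (i := b) hq hs hr (by omega)
  have hta := rowB_ge (r := r) (q := q) (i := a) hs
  have hdm := Nat.div_add_mod a q
  have hml := Nat.mod_lt a (show q > 0 by omega)
  by_cases hm : a % q = 0
  · obtain ⟨c, hc⟩ : ∃ c, c = a / q := ⟨_, rfl⟩
    have haq : a = q * c := by rw [hc]; omega
    have hc1 : 1 ≤ c := by
      rcases Nat.eq_zero_or_pos c with h | h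
      · subst h; simp at haq; omega
      · exact h
    have hcs : c < s := by
      have : q * c < q * s := by omega
      exact lt_of_mul_lt_mul_left this (Nat.zero_le _)
    obtain ⟨j, rfl⟩ : ∃ j, s = c + j := ⟨s - c, by omega⟩
    have hk : ((r - a : ℕ) : ℤ) = j * q - 1 := by
      have : (r - a) + 1 = j * q := by
        have : r + 1 = q * c + j * q := by rw [hr]; ring
        omega
      have : (((r - a : ℕ) : ℤ)) + 1 = j * q := by exact_mod_cast this
      linarith
    have hr' : (r : ℤ) = q * (c + j) - 1 := by
      have : (r : ℤ) + 1 = q * (c + j) := by exact_mod_cast hr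
      linarith
    have hj : (1 : ℤ) ≤ j := by
      have : 1 ≤ j := by omega
      exact_mod_cast this
    have hc' : (1 : ℤ) ≤ c := by exact_mod_cast hc1
    have : alphaFloor r (c + j) (r - a + 1) ≤ alphaFloor r (c + j) (r - a) := by
      apply alphaFloor_succ_le' (by omega) _ ((j : ℤ) * q - j - 1)
      · rw [hk, hr']
        push_cast
        nlinarith
      · rw [hk, hr']
        push_cast
        nlinarith
    nlinarith
  · have h1 := alphaFloor_succ_le (r := r) (s := s) (by omega) (r - a)
    have hb : b = q * (a / q) + (a % q - 1) := by omega
    have hbm : b % q = a % q - 1 := by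
      rw [hb, Nat.mul_add_mod, Nat.mod_eq_of_lt (by omega)]
    have hbd : b / q = a / q := by
      rw [hb, Nat.mul_add_div (by omega), Nat.div_eq_of_lt (show a % q - 1 < q by omega), Nat.add_zero]
    have h2 : tauB q s a = tauB q s b + s := by
      unfold tauB
      rw [hbm, hbd]
      have : ((a % q : ℕ) : ℤ) = ((a % q - 1 : ℕ) : ℤ) + 1 := by omega
      rw [this]
      ring
    unfold rowB
    rw [if_neg hm, h2]
    nlinarith

theorem caseB {r q s : ℕ} (hr : 2 ≤ r) (hs : 2 ≤ s) (hsr : s ≤ r) (hq : 2 ≤ q)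
    (hrq : r + 1 = q * s) (S : Fin r → ℂ)
    (hS : ∀ j : Fin r, S j = 0) (M : Matrix (Fin r) (Fin r) ℂ) :
    PoleLE (fun z => (z ^ ((s : ℤ) - (r : ℤ)) • (1 : Matrix (Fin r) (Fin r) ℂ)
              - shiftedF r s S z - M).det
            - (z ^ ((s : ℤ) - (r : ℤ)) • (1 : Matrix (Fin r) (Fin r) ℂ)
              - shiftedF r s S z).det) ((r : ℤ) * ((r : ℤ) - s) + s - 1) := by
  refine PoleLE.det_sub (fun z => z ^ ((s : ℤ) - (r : ℤ)) • (1 : Matrix (Fin r) (Fin r) ℂ)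
              - shiftedF r s S z) M _ fun σ i₀ => ?_
  let x : Fin r → ℤ := fun i => rowB r q s i
  let y : Fin r → ℤ := fun i => - tauB q s i
  have hxy : ∀ a b : Fin r, 0 ≤ x a + y b := by
    intro a b
    have ha := rowB_ge (r := r) (q := q) (i := (a : ℕ)) hs
    have hb := tauB_le (i := (b : ℕ)) hq hs hrq b.2
    simp only [x, y]
    omega
  refine ⟨fun i => x (σ i) + y i, fun i hi => ?_, ?_⟩
  · refine ⟨hxy _ _, entry_bound hr (by omega) hsr S (fun j _ => hS j) _ _ _ (hxy _ _) ?_ ?_ ?_⟩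
    · intro h
      have := rowB_diag (r := r) (q := q) (i := (i : ℕ)) hs
      simp only [x, y, h]
      split_ifs at this <;> omega
    · intro h
      have := edgeB hq hs hrq (σ i).2 h
      simp only [x, y]
      omega
    · rintro _ _ ⟨j, hj⟩
      exact absurd (hS j) hj
  · rw [sum_potential]
    have h1 := hxy (σ i₀) i₀
    have h2 : ∑ i, (x i + y i) ≤ (r : ℤ) * ((r : ℤ) - s) + (s - 1) := by
      have : ∀ i : Fin r, x i + y i = ((r : ℤ) - s) +
          if ((i : ℕ) % q = 0 ∧ (i : ℕ) / q ≠ s - 1) then 1 else 0 := by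
        intro i
        rw [← rowB_diag (r := r) (q := q) (i := (i : ℕ)) hs]
        simp only [x, y]
        ring
      simp only [this, Finset.sum_add_distrib, Finset.sum_const, Finset.card_univ,
        Fintype.card_fin, nsmul_eq_mul, Finset.sum_boole]
      have hcard : (Finset.univ.filter fun i : Fin r =>
          (i : ℕ) % q = 0 ∧ (i : ℕ) / q ≠ s - 1).card ≤ (Finset.range (s - 1)).card := by
        refine Finset.card_le_card_of_injOn (fun i => (i : ℕ) / q) ?_ ?_
        · intro i hi
          simp only [Finset.coe_filter, Finset.mem_univ, true_and, Set.mem_ofPred_eq] at hi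
          have : (i : ℕ) / q < s := by
            rw [Nat.div_lt_iff_lt_mul (by omega), Nat.mul_comm]
            have := i.2
            omega
          simp only [Finset.coe_range, Set.mem_Iio]
          omega
        · intro i hi j hj hij
          simp only [Finset.coe_filter, Finset.mem_univ, true_and, Set.mem_ofPred_eq] at hi hj
          simp only at hij
          have h3 := Nat.div_add_mod (i : ℕ) q
          have h4 := Nat.div_add_mod (j : ℕ) q
          apply Fin.ext
          rw [← h3, ← h4, hij, hi.1, hj.1]
      rw [Finset.card_range] at hcard
      have : ((Finset.univ.filter fun i : Fin r =>
          (i : ℕ) % q = 0 ∧ (i : ℕ) / q ≠ s - 1).card : ℤ) ≤ (s : ℤ) - 1 := by omega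
      linarith
    omega

/-- For `2 ≤ s ≤ r`, if either `r ≡ 1 (mod s)` and `S_j = 0` for all `j ≥ 2`, or
`r mod s ∈ {1, s−1}` and all `S_j = 0`, then `z^{(r−1)(r+1−s)} (D(z,M) − D(z,0))`
is a polynomial in `z` for every constant matrix `M`, i.e. `D(z,M) − D(z,0)` is
holomorphic at `z = 0` (Assumption 5* for the shifted `(r,s)` quantum curve). -/
theorem stmt12 (r s : ℕ) (hr : 2 ≤ r) (hs : 2 ≤ s) (hsr : s ≤ r)
    (S : Fin r → ℂ)
    (hcond :
      (r % s = 1 ∧ ∀ j : Fin r, 1 ≤ (j : ℕ) → S j = 0)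
        ∨ ((r % s = 1 ∨ r % s = s - 1) ∧ ∀ j : Fin r, S j = 0))
    (M : Matrix (Fin r) (Fin r) ℂ) :
    ∃ P : Polynomial ℂ, ∀ z : ℂ, z ≠ 0 →
      z ^ ((r - 1) * (r + 1 - s)) *
          ((z ^ ((s : ℤ) - (r : ℤ)) • (1 : Matrix (Fin r) (Fin r) ℂ)
              - shiftedF r s S z - M).det
            - (z ^ ((s : ℤ) - (r : ℤ)) • (1 : Matrix (Fin r) (Fin r) ℂ)
              - shiftedF r s S z).det)
        = P.eval z := by
  have main : PoleLE (fun z => (z ^ ((s : ℤ) - (r : ℤ)) • (1 : Matrix (Fin r) (Fin r) ℂ)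
              - shiftedF r s S z - M).det
            - (z ^ ((s : ℤ) - (r : ℤ)) • (1 : Matrix (Fin r) (Fin r) ℂ)
              - shiftedF r s S z).det) ((r : ℤ) * ((r : ℤ) - s) + s - 1) := by
    have hdm := Nat.div_add_mod r s
    have hq1 : 1 ≤ r / s := Nat.div_pos hsr (by omega)
    have hA : r % s = 1 → r = r / s * s + 1 := by
      intro h
      rw [Nat.mul_comm]
      omega
    rcases hcond with ⟨h1, h2⟩ | ⟨h1 | h1, h2⟩
    · exact caseA hr hs hsr hq1 (hA h1) S h2 M
    · exact caseA hr hs hsr hq1 (hA h1) S (fun j _ => h2 j) M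
    · refine caseB (q := r / s + 1) hr hs hsr (by omega) ?_ S h2 M
      rw [Nat.add_mul, Nat.mul_comm (r / s) s]
      omega
  obtain ⟨P, hP⟩ := main
  refine ⟨P, fun z hz => ?_⟩
  rw [← hP z hz, ← zpow_natCast z]
  congr 2
  have e1 : ((r - 1 : ℕ) : ℤ) = r - 1 := by omega
  have e2 : ((r + 1 - s : ℕ) : ℤ) = r + 1 - s := by omega
  rw [Nat.cast_mul, e1, e2]
  ring
end
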